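/- Let U and V be independent standard Gaussian random variables. Then E[U² (U + 2V)² (U − 2V)²] = 39 and E[U²] · E[(U + 2V)² (U − 2V)²] = 43; in particular E[U² (U + 2V)² (U − 2V)²] < E[U²] · E[(U + 2V)² (U − 2V)²], so the 'split' Gaussian product inequality E[∏|X_j|^{α_j}] ≥ E[∏_{j≤k}|X_j|^{α_j}] · E[∏_{j>k}|X_j|^{α_j}] fails for the centered Gaussian vector (U, U+2V, U−2V) with all exponents equal to 2. -/

import Mathlib

open MeasureTheory ProbabilityTheory

/-- The derivatives of `t ↦ exp (t ^ 2 / 2)` satisfy a three-term recurrence. -/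
lemma iteratedDeriv_exp_sq_half (n : ℕ) (t : ℝ) :
    iteratedDeriv (n + 2) (fun s : ℝ ↦ Real.exp (s ^ 2 / 2)) t =
      t * iteratedDeriv (n + 1) (fun s : ℝ ↦ Real.exp (s ^ 2 / 2)) t +
        (n + 1) * iteratedDeriv n (fun s : ℝ ↦ Real.exp (s ^ 2 / 2)) t := by
  set f : ℝ → ℝ := fun s ↦ Real.exp (s ^ 2 / 2) with hf
  have hsmooth : ContDiff ℝ ⊤ f := by fun_prop
  have hd (k : ℕ) (s : ℝ) : HasDerivAt (iteratedDeriv k f) (iteratedDeriv (k + 1) f s) s := by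
    rw [iteratedDeriv_succ]
    exact (hsmooth.differentiable_iteratedDeriv k
      (WithTop.coe_lt_top _) s).hasDerivAt
  have hf' (s : ℝ) : HasDerivAt f (s * f s) s := by
    convert (((hasDerivAt_id' s).fun_pow 2).div_const 2).exp using 1
    simp only [hf]
    ring
  have h1 : iteratedDeriv 1 f = fun s ↦ s * f s := by
    rw [iteratedDeriv_one]
    exact funext fun s ↦ (hf' s).deriv
  induction n generalizing t with
  | zero =>
    rw [iteratedDeriv_succ, h1, ((hasDerivAt_id' t).fun_mul (hf' t)).deriv]
    simp only [iteratedDeriv_zero]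
    push_cast
    ring
  | succ k ih =>
    rw [iteratedDeriv_succ, funext ih,
      (((hasDerivAt_id' t).fun_mul (hd (k + 1) t)).fun_add ((hd k t).const_mul _)).deriv]
    push_cast
    linear_combination t * ih t

/-- The moments of a standard Gaussian are the derivatives at zero of its moment generating
function. -/
lemma integral_pow_gaussianReal (n : ℕ) :
    ∫ x, x ^ n ∂(gaussianReal 0 1) =
      iteratedDeriv n (fun s : ℝ ↦ Real.exp (s ^ 2 / 2)) 0 := by
  have h := iteratedDeriv_mgf_zero (X := id) (μ := gaussianReal 0 1)
    (by simp [integrableExpSet_id_gaussianReal]) n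
  rw [mgf_id_gaussianReal] at h
  simpa using h.symm

lemma integral_pow_add_two_gaussianReal (n : ℕ) :
    ∫ x, x ^ (n + 2) ∂(gaussianReal 0 1) = (n + 1) * ∫ x, x ^ n ∂(gaussianReal 0 1) := by
  simp only [integral_pow_gaussianReal, iteratedDeriv_exp_sq_half, zero_mul, zero_add]

lemma integrable_pow_gaussianReal (n : ℕ) :
    Integrable (fun x ↦ x ^ n) (gaussianReal 0 1) :=
  integrable_pow_of_mem_interior_integrableExpSet (X := id)
    (by simp [integrableExpSet_id_gaussianReal]) n

/-- For independent standard Gaussians `U, V`: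
`E[U² (U+2V)² (U-2V)²] = 39` while `E[U²] E[(U+2V)² (U-2V)²] = 43`; in particular
the "split" Gaussian product inequality fails for the centered Gaussian vector
`(U, U+2V, U-2V)` with all exponents equal to `2`. -/
theorem split_gaussian_product_inequality_fails
    {Ω : Type*} [MeasurableSpace Ω] (P : Measure Ω) [IsProbabilityMeasure P]
    (U V : Ω → ℝ)
    (hU : Measure.map U P = gaussianReal 0 1)
    (hV : Measure.map V P = gaussianReal 0 1)
    (hindep : IndepFun U V P) :
    (∫ ω, (U ω) ^ 2 * (U ω + 2 * V ω) ^ 2 * (U ω - 2 * V ω) ^ 2 ∂P) = 39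
      ∧ (∫ ω, (U ω) ^ 2 ∂P) * (∫ ω, (U ω + 2 * V ω) ^ 2 * (U ω - 2 * V ω) ^ 2 ∂P) = 43
      ∧ (∫ ω, (U ω) ^ 2 * (U ω + 2 * V ω) ^ 2 * (U ω - 2 * V ω) ^ 2 ∂P)
          < (∫ ω, (U ω) ^ 2 ∂P) * (∫ ω, (U ω + 2 * V ω) ^ 2 * (U ω - 2 * V ω) ^ 2 ∂P) := by
  have aemeas {X : Ω → ℝ} (hX : Measure.map X P = gaussianReal 0 1) : AEMeasurable X P :=
    AEMeasurable.of_map_ne_zero (by rw [hX]; exact IsProbabilityMeasure.ne_zero _)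
  have moment_eq {X : Ω → ℝ} (hX : Measure.map X P = gaussianReal 0 1) (n : ℕ) :
      ∫ ω, X ω ^ n ∂P = ∫ x, x ^ n ∂(gaussianReal 0 1) := by
    rw [← hX, integral_map (aemeas hX) (by fun_prop)]
  have int_pow {X : Ω → ℝ} (hX : Measure.map X P = gaussianReal 0 1) (n : ℕ) :
      Integrable (fun ω ↦ X ω ^ n) P := by
    have h := integrable_pow_gaussianReal n
    rw [← hX] at h
    exact h.comp_aemeasurable (aemeas hX)
  have indep_pow (m n : ℕ) : IndepFun (fun ω ↦ U ω ^ m) (fun ω ↦ V ω ^ n) P :=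
    hindep.comp (measurable_id.pow_const m) (measurable_id.pow_const n)
  have int_mul (m n : ℕ) : Integrable (fun ω ↦ U ω ^ m * V ω ^ n) P :=
    (indep_pow m n).integrable_mul (int_pow hU m) (int_pow hV n)
  have mixed (m n : ℕ) : ∫ ω, U ω ^ m * V ω ^ n ∂P =
      (∫ x, x ^ m ∂(gaussianReal 0 1)) * ∫ x, x ^ n ∂(gaussianReal 0 1) := by
    rw [← moment_eq hU, ← moment_eq hV]
    exact (indep_pow m n).integral_fun_mul_eq_mul_integral
      (int_pow hU m).aestronglyMeasurable (int_pow hV n).aestronglyMeasurable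
  have m0 : ∫ x, x ^ 0 ∂(gaussianReal 0 1) = 1 := by simp
  have m2 : ∫ x, x ^ 2 ∂(gaussianReal 0 1) = 1 := by
    rw [integral_pow_add_two_gaussianReal 0, m0]; norm_num
  have m4 : ∫ x, x ^ 4 ∂(gaussianReal 0 1) = 3 := by
    rw [integral_pow_add_two_gaussianReal 2, m2]; norm_num
  have m6 : ∫ x, x ^ 6 ∂(gaussianReal 0 1) = 15 := by
    rw [integral_pow_add_two_gaussianReal 4, m4]; norm_num
  have expand (k : ℕ) : ∫ ω, U ω ^ k * ((U ω + 2 * V ω) ^ 2 * (U ω - 2 * V ω) ^ 2) ∂P =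
      (∫ ω, U ω ^ (k + 4) * V ω ^ 0 ∂P) - 8 * (∫ ω, U ω ^ (k + 2) * V ω ^ 2 ∂P) +
        16 * ∫ ω, U ω ^ k * V ω ^ 4 ∂P := by
    have hsub : Integrable (fun ω ↦ U ω ^ (k + 4) * V ω ^ 0 - 8 * (U ω ^ (k + 2) * V ω ^ 2)) P :=
      (int_mul _ _).sub ((int_mul _ _).const_mul _)
    rw [← integral_const_mul, ← integral_const_mul,
      ← integral_sub (int_mul _ _) ((int_mul _ _).const_mul _),
      ← integral_add hsub ((int_mul _ _).const_mul _)]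
    congr with ω
    ring
  have full : ∫ ω, U ω ^ 2 * (U ω + 2 * V ω) ^ 2 * (U ω - 2 * V ω) ^ 2 ∂P = 39 := by
    have h := expand 2
    norm_num only [mixed, m0, m2, m4, m6] at h
    simpa only [mul_assoc] using h
  have pair : ∫ ω, (U ω + 2 * V ω) ^ 2 * (U ω - 2 * V ω) ^ 2 ∂P = 43 := by
    have h := expand 0
    norm_num only [mixed, m0, m2, m4] at h
    simpa only [pow_zero, one_mul] using h
  rw [full, pair, moment_eq hU, m2]
  norm_num
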